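/- arXiv:2312.07023 — 2 statements merged into one kernel-verified Lean document; each statement's English description precedes it below -/
import Mathlib

section
/- Let (x_k) be generated by the inexact Sublinear Contracting PPA recursion for the λ-cocoercive operator F, and suppose F(x_*) = 0. Then: (1) the sequence (v_k) is bounded; (2) ∑_{k≥0} |⟨v_{k+1} − x_*, g_k⟩| < ∞; (3) ∑_{k≥0} (μ/τ_k^{p−1}) ⟨x_k − x_*, F(x_k)⟩ < ∞; (4) ∑_{k≥0} ((1−τ_k)/τ_k^{p+1}) ‖F(x_{k+1}) − F(x_k)‖² < ∞; (5) ∑_{k≥0} ‖v_{k+1} − v_k‖² < ∞; (6) ∑_{k≥0} β((2−τ_k)/(2τ_k)) ‖x_{k+1} − x_k‖² < ∞. -/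
open Filter Topology
open scoped InnerProductSpace

theorem aux_real (E D w δ : ℕ → ℝ) (hE : ∀ k, 0 ≤ E k) (hD : ∀ k, 0 ≤ D k)
    (hw0 : ∀ k, 0 ≤ w k) (hw : ∀ k, w k ^ 2 ≤ 2 * E k) (hδ0 : ∀ k, 0 ≤ δ k) (hδ : Summable δ)
    (h : ∀ k, E (k + 1) + D k ≤ E k + w (k + 1) * δ k) :
    (∃ M, ∀ k, w k ≤ M) ∧ Summable D := by
  have hws : ∀ k, w k ≤ √(2 * E k) := fun k => Real.le_sqrt_of_sq_le (hw k)
  have hs2 : ∀ k, √(2 * E k) ^ 2 = 2 * E k := fun k => Real.sq_sqrt (by linarith [hE k])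
  have hstep : ∀ k, √(2 * E (k + 1)) ≤ √(2 * E k) + 2 * δ k := by
    intro k
    by_contra! hc
    have h1 := hs2 k
    have h2 := hs2 (k + 1)
    have h3 := mul_le_mul_of_nonneg_right (hws (k + 1)) (hδ0 k)
    have h4 := Real.sqrt_nonneg (2 * E k)
    have h5 := Real.sqrt_nonneg (2 * E (k + 1))
    have h6 := h k
    have h7 := hD k
    have h8 := hδ0 k
    generalize √(2 * E (k + 1)) = s' at *
    generalize √(2 * E k) = s at *
    have h9 : s' * (s + 2 * δ k) < s' * s' := mul_lt_mul_of_pos_left hc (by linarith)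
    have h10 : s * s ≤ s' * s := mul_le_mul_of_nonneg_right (by linarith) h4
    nlinarith
  have hsum : ∀ k, √(2 * E k) ≤ √(2 * E 0) + 2 * ∑ i ∈ Finset.range k, δ i := by
    intro k
    induction k with
    | zero => simp
    | succ k ih => rw [Finset.sum_range_succ]; linarith [hstep k]
  have hM : ∀ k, w k ≤ √(2 * E 0) + 2 * ∑' i, δ i := by
    intro k
    have := hδ.sum_le_tsum (Finset.range k) (fun i _ => hδ0 i)
    linarith [hws k, hsum k]
  refine ⟨⟨_, hM⟩, ?_⟩
  set M := √(2 * E 0) + 2 * ∑' i, δ i with hMdef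
  have hM0 : 0 ≤ M := (hw0 0).trans (hM 0)
  have hp : ∀ k, E k + ∑ i ∈ Finset.range k, D i ≤ E 0 + M * ∑ i ∈ Finset.range k, δ i := by
    intro k
    induction k with
    | zero => simp
    | succ k ih =>
      rw [Finset.sum_range_succ, Finset.sum_range_succ]
      have := mul_le_mul_of_nonneg_right (hM (k + 1)) (hδ0 k)
      linarith [h k]
  refine summable_of_sum_range_le (c := E 0 + M * ∑' i, δ i) hD fun k => ?_
  have := mul_le_mul_of_nonneg_left (hδ.sum_le_tsum (Finset.range k) (fun i _ => hδ0 i)) hM0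
  linarith [hp k, hE k]

theorem aux_step {H : Type*} [NormedAddCommGroup H] [InnerProductSpace ℝ H]
    (lam t A β : ℝ) (ht : 1 ≤ t) (hA : 0 ≤ A) (x y v v' fx fy g s : H)
    (hF : lam * ‖fy - fx‖ ^ 2 ≤ ⟪fy - fx, y - x⟫_ℝ)
    (hv : v' = t • y - (t - 1) • x)
    (h : (0 : H) = (A * t) • fy - (A * (t - 1)) • fx + (v' - v) + β • (y - x) + g) :
    ‖v' - s‖ ^ 2 / 2 + A * t * ⟪y - s, fy⟫_ℝ + β / 2 * ‖y - s‖ ^ 2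
      + lam * (A * t * (t - 1) * ‖fy - fx‖ ^ 2) + ‖v' - v‖ ^ 2 / 2
      + β * (t - 1 / 2) * ‖y - x‖ ^ 2
    ≤ ‖v - s‖ ^ 2 / 2 + A * (t - 1) * ⟪x - s, fx⟫_ℝ + β / 2 * ‖x - s‖ ^ 2
      + ‖v' - s‖ * ‖g‖ := by
  have hc := neg_le_of_abs_le (abs_real_inner_le_norm (v' - s) g)
  have hm := mul_le_mul_of_nonneg_left hF
    (mul_nonneg (mul_nonneg hA (by linarith)) (by linarith) : 0 ≤ A * t * (t - 1))
  have h0 : ⟪v' - s, (A * t) • fy - (A * (t - 1)) • fx + (v' - v) + β • (y - x) + g⟫_ℝ = 0 := by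
    rw [← h, inner_zero_right]
  have e1 : ⟪v' - s, v' - v⟫_ℝ = ‖v' - s‖ ^ 2 / 2 - ‖v - s‖ ^ 2 / 2 + ‖v' - v‖ ^ 2 / 2 := by
    have : v - s = (v' - s) - (v' - v) := by abel
    rw [this, norm_sub_sq_real (v' - s) (v' - v)]; ring
  have e2 : ⟪v' - s, y - x⟫_ℝ = ‖y - s‖ ^ 2 / 2 - ‖x - s‖ ^ 2 / 2 + (t - 1 / 2) * ‖y - x‖ ^ 2 := by
    have h1 : v' - s = (y - s) + (t - 1) • (y - x) := by rw [hv]; module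
    have h2 : x - s = (y - s) - (y - x) := by abel
    rw [h1, h2, norm_sub_sq_real (y - s) (y - x), inner_add_left, real_inner_smul_left, real_inner_self_eq_norm_sq]
    ring
  have e3 : ⟪v' - s, (A * t) • fy - (A * (t - 1)) • fx⟫_ℝ = A * t * ⟪y - s, fy⟫_ℝ
      - A * (t - 1) * ⟪x - s, fx⟫_ℝ + A * t * (t - 1) * ⟪fy - fx, y - x⟫_ℝ := by
    rw [hv]
    simp only [inner_sub_left, inner_sub_right, real_inner_smul_left, real_inner_smul_right,
      real_inner_comm y, real_inner_comm x]
    ring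
  rw [inner_add_right, inner_add_right, inner_add_right, e1, e3, real_inner_smul_right, e2] at h0
  linarith

/-- Boundedness and summability properties of the inexact Sublinear
Contracting PPA applied to a λ-cocoercive operator `F` with `F x_* = 0`. -/
theorem sublinear_contracting_ppa_summability
    {H : Type*} [NormedAddCommGroup H] [InnerProductSpace ℝ H] [CompleteSpace H]
    (lam : ℝ) (hlam : 0 < lam) (F : H → H)
    (hF : ∀ x y : H, lam * ‖F x - F y‖ ^ 2 ≤ ⟪F x - F y, x - y⟫_ℝ)
    (μ p a : ℝ) (hμ0 : 0 ≤ μ) (hμ1 : μ < 1) (hp : 1 ≤ p)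
    (ha0 : 0 < a) (ha : a ≤ (1 - μ) / p)
    (τ : ℕ → ℝ) (hτ : ∀ k : ℕ, τ k = 1 / (a * (k : ℝ) + 1))
    (τneg : ℝ) (hτneg0 : 0 < τneg) (hτneg1 : τneg ≤ 1)
    (x : ℕ → H)
    (v : ℕ → H)
    (hv0 : v 0 = (1 / τneg) • x 0 - ((1 - τneg) / τneg) • x 0)
    (hv : ∀ k, v (k + 1) = (1 / τ k) • x (k + 1) - ((1 - τ k) / τ k) • x k)
    (β : ℝ) (hβ : 0 ≤ β)
    (δ : ℕ → ℝ) (hδ0 : ∀ k, 0 ≤ δ k) (hδ : Summable δ)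
    (g : ℕ → H) (hg : ∀ k, ‖g k‖ ≤ δ k)
    (hx : ∀ k, (0 : H) = (1 / τ k ^ p) • F (x (k + 1)) -
      ((1 - τ k) / τ k ^ p) • F (x k) + (v (k + 1) - v k) +
      β • (x (k + 1) - x k) + g k)
    (xs : H) (hxs : F xs = 0) :
    (∃ M : ℝ, ∀ k, ‖v k‖ ≤ M) ∧
    Summable (fun k => |⟪v (k + 1) - xs, g k⟫_ℝ|) ∧
    Summable (fun k => (μ / τ k ^ (p - 1)) * ⟪x k - xs, F (x k)⟫_ℝ) ∧
    Summable (fun k =>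
      ((1 - τ k) / τ k ^ (p + 1)) * ‖F (x (k + 1)) - F (x k)‖ ^ 2) ∧
    Summable (fun k => ‖v (k + 1) - v k‖ ^ 2) ∧
    Summable (fun k => β * ((2 - τ k) / (2 * τ k)) * ‖x (k + 1) - x k‖ ^ 2) := by
  set t : ℕ → ℝ := fun k => a * (k : ℝ) + 1 with htdef
  have ht1 : ∀ k, 1 ≤ t k := fun k => by
    have : 0 ≤ a * (k : ℝ) := by positivity
    simp only [htdef]; linarith
  have ht0 : ∀ k, 0 < t k := fun k => by linarith [ht1 k]
  have hτt : ∀ k, τ k = (t k)⁻¹ := fun k => by rw [hτ k, one_div]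
  have htp : ∀ k, t k ^ p = t k ^ (p - 1) * t k := fun k => by
    rw [← Real.rpow_add_one (ht0 k).ne']; congr 1; ring
  have hApos : ∀ k, 0 < t k ^ (p - 1) := fun k => Real.rpow_pos_of_pos (ht0 k) _
  have hinv : ∀ (k : ℕ) (q : ℝ), τ k ^ q = (t k ^ q)⁻¹ := fun k q => by
    rw [hτt k, Real.inv_rpow (ht0 k).le]
  have hmono : ∀ y, 0 ≤ ⟪y - xs, F y⟫_ℝ := fun y => by
    have := hF y xs
    rw [hxs, sub_zero, real_inner_comm] at this
    exact le_trans (by positivity) this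
  have hpa : p * a ≤ 1 - μ := by
    rw [le_div_iff₀ (by linarith)] at ha; linarith
  have hbern : ∀ k, t (k + 1) ^ (p - 1) * (t (k + 1) - (1 - μ)) ≤ t k ^ (p - 1) * t k := by
    intro k
    have hk := ht0 k
    have hk1 := ht0 (k + 1)
    have hta : t k = t (k + 1) * (1 + -(a / t (k + 1))) := by
      have : t k = t (k + 1) - a := by simp only [htdef]; push_cast; ring
      rw [this]; field_simp; ring
    have hle : a / t (k + 1) ≤ 1 := by
      rw [div_le_one hk1]; simp only [htdef]; push_cast
      have : 0 ≤ a * (k : ℝ) := by positivity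
      linarith
    have hb := one_add_mul_self_le_rpow_one_add (s := -(a / t (k + 1))) (by linarith) hp
    rw [← htp k]
    conv_rhs => rw [hta, Real.mul_rpow hk1.le (by linarith), htp (k + 1)]
    have h1 := mul_le_mul_of_nonneg_left hb (mul_pos (hApos (k + 1)) hk1).le
    refine le_trans ?_ h1
    rw [mul_assoc]
    refine mul_le_mul_of_nonneg_left ?_ (hApos (k + 1)).le
    have : t (k + 1) * (1 + p * -(a / t (k + 1))) = t (k + 1) - p * a := by
      field_simp; ring
    rw [this]; linarith
  have hstep : ∀ k, _ := fun k => aux_step lam (t k) (t k ^ (p - 1)) β (ht1 k) (hApos k).le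
    (x k) (x (k + 1)) (v k) (v (k + 1)) (F (x k)) (F (x (k + 1))) (g k) xs (hF _ _)
    (by
      rw [hv k, hτt k]
      have := (ht0 k).ne'
      congr 2 <;> field_simp)
    (by
      rw [← htp k]
      have e1 : 1 / τ k ^ p = t k ^ p := by rw [hinv, one_div, inv_inv]
      have e2 : (1 - τ k) / τ k ^ p = t k ^ (p - 1) * (t k - 1) := by
        rw [hinv, div_inv_eq_mul, htp, hτt]
        have := (ht0 k).ne'
        field_simp
      have := hx k
      rwa [e1, e2] at this)
  have key := aux_real
    (fun k => ‖v k - xs‖ ^ 2 / 2 + t k ^ (p - 1) * (t k - (1 - μ)) * ⟪x k - xs, F (x k)⟫_ℝ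
      + β / 2 * ‖x k - xs‖ ^ 2)
    (fun k => μ * t k ^ (p - 1) * ⟪x k - xs, F (x k)⟫_ℝ
      + lam * (t k ^ (p - 1) * t k * (t k - 1) * ‖F (x (k + 1)) - F (x k)‖ ^ 2)
      + ‖v (k + 1) - v k‖ ^ 2 / 2 + β * (t k - 1 / 2) * ‖x (k + 1) - x k‖ ^ 2)
    (fun k => ‖v k - xs‖) δ
  have n1 : ∀ k, 0 ≤ μ * t k ^ (p - 1) * ⟪x k - xs, F (x k)⟫_ℝ := fun k =>
    mul_nonneg (mul_nonneg hμ0 (hApos k).le) (hmono _)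
  have n2 : ∀ k, 0 ≤ t k ^ (p - 1) * t k * (t k - 1) * ‖F (x (k + 1)) - F (x k)‖ ^ 2 := fun k =>
    mul_nonneg (mul_nonneg (mul_nonneg (hApos k).le (ht0 k).le) (by linarith [ht1 k])) (sq_nonneg _)
  have n2' : ∀ k, 0 ≤ lam * (t k ^ (p - 1) * t k * (t k - 1) * ‖F (x (k + 1)) - F (x k)‖ ^ 2) :=
    fun k => mul_nonneg hlam.le (n2 k)
  have n3 : ∀ k, 0 ≤ ‖v (k + 1) - v k‖ ^ 2 / 2 := fun k => by positivity
  have n4 : ∀ k, 0 ≤ β * (t k - 1 / 2) * ‖x (k + 1) - x k‖ ^ 2 := fun k =>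
    mul_nonneg (mul_nonneg hβ (by linarith [ht1 k])) (sq_nonneg _)
  have m1 : ∀ k, 0 ≤ t k ^ (p - 1) * (t k - (1 - μ)) * ⟪x k - xs, F (x k)⟫_ℝ := fun k =>
    mul_nonneg (mul_nonneg (hApos k).le (by linarith [ht1 k])) (hmono _)
  have m2 : ∀ k, 0 ≤ β / 2 * ‖x k - xs‖ ^ 2 := fun k => by positivity
  obtain ⟨⟨M, hM⟩, hD⟩ := key
    (fun k => by have := m1 k; have := m2 k; positivity)
    (fun k => by have := n1 k; have := n2' k; have := n3 k; have := n4 k; positivity)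
    (fun k => norm_nonneg _)
    (fun k => by have := m1 k; have := m2 k; linarith)
    hδ0 hδ
    (fun k => by
      have h1 := hstep k
      have h2 := mul_le_mul_of_nonneg_right (hbern k) (hmono (x (k + 1)))
      have h3 := mul_le_mul_of_nonneg_left (hg k) (norm_nonneg (v (k + 1) - xs))
      linarith)
  refine ⟨⟨M + ‖xs‖, fun k => ?_⟩, ?_, ?_, ?_, ?_, ?_⟩
  · have := norm_add_le (v k - xs) xs
    rw [sub_add_cancel] at this
    linarith [hM k]
  · refine Summable.of_nonneg_of_le (fun k => abs_nonneg _) (fun k => ?_) (hδ.mul_left M)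
    exact (abs_real_inner_le_norm _ _).trans
      (mul_le_mul (hM (k + 1)) (hg k) (norm_nonneg _) ((norm_nonneg _).trans (hM 0)))
  · have e : ∀ k, μ / τ k ^ (p - 1) = μ * t k ^ (p - 1) := fun k => by
      rw [hinv, div_inv_eq_mul]
    simp only [e]
    exact Summable.of_nonneg_of_le n1 (fun k => by linarith [n2' k, n3 k, n4 k]) hD
  · have e : ∀ k, (1 - τ k) / τ k ^ (p + 1) = t k ^ (p - 1) * t k * (t k - 1) := fun k => by
      rw [hinv, div_inv_eq_mul, Real.rpow_add_one (ht0 k).ne', htp, hτt]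
      have := (ht0 k).ne'
      field_simp
    simp only [e]
    rw [← summable_mul_left_iff hlam.ne']
    exact Summable.of_nonneg_of_le n2' (fun k => by linarith [n1 k, n3 k, n4 k]) hD
  · exact Summable.of_nonneg_of_le (fun k => sq_nonneg _)
      (fun k => by linarith [n1 k, n2' k, n3 k, n4 k]) (hD.mul_left 2)
  · have e : ∀ k, (2 - τ k) / (2 * τ k) = t k - 1 / 2 := fun k => by
      rw [hτt]
      have := (ht0 k).ne'
      field_simp
    simp only [e]
    exact Summable.of_nonneg_of_le n4 (fun k => by linarith [n1 k, n2' k, n3 k]) hD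
end

section
/- Let (x_k) be generated by the inexact Sublinear Contracting PPA recursion for the λ-cocoercive operator F with μ ∈ (0,1) and β > 0, and suppose F(x_*) = 0. Then (x_k) converges weakly to some x̄ ∈ H with F(x̄) = 0 (weak convergence meaning ⟨x_k, y⟩ → ⟨x̄, y⟩ for every y ∈ H). -/
open Filter Topology
open scoped InnerProductSpace

lemma aux_energy (E A d : ℕ → ℝ) (hE : ∀ k, 0 ≤ E k) (hA : ∀ k, 0 ≤ A k) (hd : ∀ k, 0 ≤ d k)
    (hds : Summable d) (h : ∀ k, E (k+1) + A k ≤ E k + d k * Real.sqrt (2 * E (k+1))) :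
    (∃ M, ∀ k, E k ≤ M) ∧ Summable A ∧ Summable (fun k => |E (k+1) - E k|) := by
  set R : ℕ → ℝ := fun k => Real.sqrt (2 * E k) with hR
  have hR0 : ∀ k, 0 ≤ R k := fun k => Real.sqrt_nonneg _
  have hR2 : ∀ k, R k ^ 2 = 2 * E k := fun k => Real.sq_sqrt (by have := hE k; linarith)
  have hstep : ∀ k, R (k+1) ≤ R k + 2 * d k := by
    intro k
    have h1 := h k
    have h2 := hR2 k
    have h3 := hR2 (k+1)
    have h4 : E (k+1) + A k ≤ E k + d k * R (k+1) := h1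
    have := hA k
    have := hd k
    have := hR0 k
    have h5 : (R (k+1) - d k)^2 ≤ (R k + d k)^2 := by nlinarith [mul_nonneg (hR0 k) (hd k)]
    have := abs_le_of_sq_le_sq h5 (by linarith)
    linarith [le_abs_self (R (k+1) - d k)]
  have hsum : ∀ n, ∑ i ∈ Finset.range n, d i ≤ ∑' i, d i := fun n =>
    hds.sum_le_tsum _ (fun i _ => hd i)
  have hRb : ∀ n, R n ≤ R 0 + 2 * ∑ i ∈ Finset.range n, d i := by
    intro n
    induction n with
    | zero => simp
    | succ n ih => rw [Finset.sum_range_succ]; linarith [hstep n]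
  set B := R 0 + 2 * ∑' i, d i with hB
  have hRB : ∀ n, R n ≤ B := fun n => by linarith [hRb n, hsum n]
  have hB0 : 0 ≤ B := le_trans (hR0 0) (hRB 0)
  have h' : ∀ k, E (k+1) + A k ≤ E k + B * d k := by
    intro k
    have h4 : E (k+1) + A k ≤ E k + d k * R (k+1) := h k
    nlinarith [mul_le_mul_of_nonneg_left (hRB (k+1)) (hd k)]
  have hkey : ∀ n, E n + ∑ i ∈ Finset.range n, A i ≤ E 0 + B * ∑ i ∈ Finset.range n, d i := by
    intro n
    induction n with
    | zero => simp
    | succ n ih => rw [Finset.sum_range_succ, Finset.sum_range_succ]; linarith [h' n]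
  refine ⟨⟨B^2, fun k => ?_⟩, ?_, ?_⟩
  · nlinarith [hR2 k, hRB k, hR0 k, hE k]
  · refine summable_of_sum_range_le (c := E 0 + B * ∑' i, d i) hA fun n => ?_
    nlinarith [hkey n, hE n, mul_le_mul_of_nonneg_left (hsum n) hB0]
  · have hkey2 : ∀ n, E n + ∑ i ∈ Finset.range n, |E (i+1) - E i|
        ≤ E 0 + 2 * B * ∑ i ∈ Finset.range n, d i := by
      intro n
      induction n with
      | zero => simp
      | succ n ih =>
        rw [Finset.sum_range_succ, Finset.sum_range_succ]
        have : |E (n+1) - E n| ≤ E n - E (n+1) + 2 * B * d n := by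
          have := h' n
          have := hA n
          have := mul_nonneg hB0 (hd n)
          rw [abs_le]; constructor <;> linarith
        linarith
    refine summable_of_sum_range_le (c := E 0 + 2 * B * ∑' i, d i) (fun _ => abs_nonneg _)
      fun n => ?_
    nlinarith [hkey2 n, hE n, mul_le_mul_of_nonneg_left (hsum n) hB0]

lemma aux_conv_of_abs (f : ℕ → ℝ) (h : Summable (fun k => |f (k+1) - f k|)) :
    ∃ l, Tendsto f atTop (𝓝 l) := by
  have h1 : Summable (fun k => f (k+1) - f k) := h.of_abs
  have h2 := h1.hasSum.tendsto_sum_nat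
  refine ⟨f 0 + ∑' k, (f (k+1) - f k), ?_⟩
  have := h2.const_add (f 0)
  refine this.congr fun n => ?_
  rw [Finset.sum_range_sub]; ring

lemma aux_slow (E h w s u : ℕ → ℝ) (κ C W : ℝ) (hκ : 0 < κ) (hC : 0 ≤ C)
    (hw : ∀ k, w k = E k - κ * h k) (hWb : ∀ k, |w k| ≤ W)
    (hEs : Summable (fun k => |E (k+1) - E k|))
    (hs0 : ∀ k, 0 ≤ s k) (hsm : ∀ k, s (k+1) ≤ s k) (hsn : ¬ Summable s)
    (hsw : Summable (fun k => s k * w k ^ 2)) (hsu : Summable (fun k => s k * u k ^ 2))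
    (hh : ∀ k, |h (k+1) - h k| ≤ C * (s (k+1) * u (k+1))) :
    ∃ l, Tendsto h atTop (𝓝 l) := by
  have hW0 : 0 ≤ W := le_trans (abs_nonneg _) (hWb 0)
  have h1 : Summable (fun k => |w (k+1) ^ 2 - w k ^ 2|) := by
    have hb : Summable (fun k => 2 * W * |E (k+1) - E k| +
        κ * C * (s k * w k ^ 2 + s (k+1) * w (k+1) ^ 2 + s (k+1) * u (k+1) ^ 2)) :=
      (hEs.mul_left _).add (((hsw.add ((summable_nat_add_iff 1).2 hsw)).add
        ((summable_nat_add_iff 1).2 hsu)).mul_left _)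
    refine Summable.of_nonneg_of_le (fun _ => abs_nonneg _) (fun k => ?_) hb
    have e : w (k+1) ^ 2 - w k ^ 2 =
        (w (k+1) + w k) * (E (k+1) - E k) - κ * ((w (k+1) + w k) * (h (k+1) - h k)) := by
      have : (w (k+1) - w k) = (E (k+1) - E k) - κ * (h (k+1) - h k) := by
        rw [hw, hw]; ring
      calc _ = (w (k+1) + w k) * (w (k+1) - w k) := by ring
        _ = _ := by rw [this]; ring
    have hab : |w (k+1) + w k| ≤ |w (k+1)| + |w k| := abs_add_le _ _
    have b1 : |(w (k+1) + w k) * (E (k+1) - E k)| ≤ 2 * W * |E (k+1) - E k| := by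
      rw [abs_mul]
      exact mul_le_mul_of_nonneg_right (by linarith [hWb k, hWb (k+1)]) (abs_nonneg _)
    have b2 : |(w (k+1) + w k) * (h (k+1) - h k)| ≤
        C * (s k * w k ^ 2 + s (k+1) * w (k+1) ^ 2 + s (k+1) * u (k+1) ^ 2) := by
      rw [abs_mul]
      have c1 : |w (k+1) + w k| * |h (k+1) - h k| ≤
          (|w (k+1)| + |w k|) * (C * (s (k+1) * u (k+1))) :=
        mul_le_mul hab (hh k) (abs_nonneg _) (by positivity)
      have c2 : (|w (k+1)| + |w k|) * u (k+1) ≤ w k ^ 2 + w (k+1) ^ 2 + u (k+1) ^ 2 := by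
        rw [← sq_abs (w k), ← sq_abs (w (k+1))]
        nlinarith [sq_nonneg (|w k| - u (k+1)), sq_nonneg (|w (k+1)| - u (k+1)),
          sq_nonneg (|w k|), sq_nonneg (|w (k+1)|)]
      have c3 := mul_le_mul_of_nonneg_left c2 (hs0 (k+1))
      have c4 := mul_le_mul_of_nonneg_right (hsm k) (sq_nonneg (w k))
      have c5 : s (k+1) * ((|w (k+1)| + |w k|) * u (k+1)) ≤
        s k * w k ^ 2 + s (k+1) * w (k+1) ^ 2 + s (k+1) * u (k+1) ^ 2 := by linarith
      have c6 := mul_le_mul_of_nonneg_left c5 hC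
      linarith
    rw [e]
    refine (abs_sub _ _).trans ?_
    rw [abs_mul κ, abs_of_pos hκ]
    have := mul_le_mul_of_nonneg_left b2 hκ.le
    linarith
  obtain ⟨l, hl⟩ := aux_conv_of_abs (fun k => w k ^ 2) h1
  have hl0 : 0 ≤ l := ge_of_tendsto' hl fun k => sq_nonneg _
  have hlz : l = 0 := by
    by_contra hne
    have hlp : 0 < l := lt_of_le_of_ne hl0 (Ne.symm hne)
    have hev : ∀ᶠ k in atTop, l / 2 < w k ^ 2 := hl.eventually (lt_mem_nhds (by linarith))
    obtain ⟨N, hN⟩ := eventually_atTop.1 hev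
    apply hsn
    rw [← summable_nat_add_iff N]
    refine Summable.of_nonneg_of_le (fun k => hs0 _) (fun k => ?_)
      (((summable_nat_add_iff N).2 hsw).mul_left (2 / l))
    have := hN (k + N) (by omega)
    have h2 := mul_le_mul_of_nonneg_left this.le (hs0 (k+N))
    have h3 := mul_le_mul_of_nonneg_left h2 (show 0 ≤ 2 / l by positivity)
    have h4 : 2 / l * (s (k+N) * (l/2)) = s (k+N) := by field_simp
    linarith
  rw [hlz] at hl
  have hw0 : Tendsto w atTop (𝓝 0) := by
    have := hl.sqrt
    simp only [Real.sqrt_sq_eq_abs, Real.sqrt_zero] at this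
    exact (tendsto_zero_iff_abs_tendsto_zero _).2 this
  obtain ⟨e, he⟩ := aux_conv_of_abs E hEs
  refine ⟨(e - 0) / κ, ((he.sub hw0).div_const κ).congr fun k => ?_⟩
  rw [hw]; field_simp; ring

lemma aux_step_s14 {H : Type*} [NormedAddCommGroup H] [InnerProductSpace ℝ H]
    (X Y V V' FX FY g z : H) (t P Q P0 μ β δ : ℝ) (ht : 1 ≤ t) (hQ : 0 ≤ Q)
    (hP : P = t * Q) (hP0 : P - Q + μ * Q ≤ P0) (hβ : 0 < β)
    (hV : V' = t • Y - (t - 1) • X)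
    (heq : (0 : H) = P • FY - (P - Q) • FX + (V' - V) + β • (Y - X) + g)
    (hg : ‖g‖ ≤ δ) (h1 : 0 ≤ ⟪FX, X - z⟫_ℝ) (h2 : 0 ≤ ⟪FY - FX, Y - X⟫_ℝ) :
    P * ⟪FY, Y - z⟫_ℝ + 1/2 * ‖V' - z‖^2 + β/2 * ‖Y - z‖^2 + μ * Q * ⟪FX, X - z⟫_ℝ
      + β/2 * (t * ‖Y - X‖^2) ≤
    P0 * ⟪FX, X - z⟫_ℝ + 1/2 * ‖V - z‖^2 + β/2 * ‖X - z‖^2 + δ * ‖V' - z‖ := by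
  obtain ⟨D, rfl⟩ : ∃ D, Y = X + D := ⟨Y - X, by abel⟩
  obtain ⟨e, rfl⟩ : ∃ e, X = z + e := ⟨X - z, by abel⟩
  obtain ⟨f, rfl⟩ : ∃ f, V = z + f := ⟨V - z, by abel⟩
  have hV2 : V' = z + (e + t • D) := by rw [hV]; module
  subst hV2
  have e1 : z + e + D - z = e + D := by abel
  have e2 : z + e + D - (z + e) = D := by abel
  have e3 : z + (e + t • D) - (z + f) = e + t • D - f := by abel
  rw [e2] at h2 heq
  rw [e3] at heq
  rw [e1, e2]
  simp only [add_sub_cancel_left] at *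
  have hi : ⟪P • FY - (P - Q) • FX + (e + t • D - f) + β • D + g, e + t • D⟫_ℝ = 0 := by
    rw [← heq, inner_zero_left]
  have hgi : - (δ * ‖e + t • D‖) ≤ ⟪g, e + t • D⟫_ℝ := by
    have := abs_real_inner_le_norm g (e + t • D)
    have h3 := mul_le_mul_of_nonneg_right hg (norm_nonneg (e + t • D))
    have := (abs_le.1 this).1
    linarith
  have hff : 0 ≤ ‖e + t • D - f‖^2 := sq_nonneg _
  rw [inner_add_left] at hi
  generalize ⟪g, e + t • D⟫_ℝ = gi at *
  generalize δ * ‖e + t • D‖ = dd at *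
  simp only [← real_inner_self_eq_norm_sq] at *
  simp only [inner_add_left, inner_add_right, inner_sub_left, inner_sub_right,
    real_inner_smul_left, real_inner_smul_right] at *
  rw [real_inner_comm e D, real_inner_comm e f, real_inner_comm D f] at *
  have hDD : 0 ≤ ⟪D, D⟫_ℝ := real_inner_self_nonneg
  have k1 := mul_nonneg (mul_nonneg (by linarith : 0 ≤ t - 1) (mul_nonneg (by linarith : 0 ≤ t) hQ)) h2
  have k2 := mul_nonneg (by linarith : 0 ≤ P0 - (P - Q + μ * Q)) h1
  have k3 := mul_nonneg hβ.le (mul_nonneg (by linarith : 0 ≤ t - 1) hDD)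
  subst hP
  nlinarith

lemma aux_compact {H : Type*} [NormedAddCommGroup H] [InnerProductSpace ℝ H] [CompleteSpace H]
    (x : ℕ → H) (M : ℝ) (hM : ∀ k, ‖x k‖ ≤ M) (U : Ultrafilter ℕ) :
    ∃ xb : H, ∀ y : H, Tendsto (fun k => ⟪x k, y⟫_ℝ) U (𝓝 ⟪xb, y⟫_ℝ) := by
  have hc := WeakDual.isCompact_closedBall (𝕜 := ℝ) (E := H) 0 M
  let T : ℕ → WeakDual ℝ H := fun k => StrongDual.toWeakDual (InnerProductSpace.toDual ℝ H (x k))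
  have hT : ∀ k, T k ∈ WeakDual.toStrongDual ⁻¹' Metric.closedBall (0 : StrongDual ℝ H) M := by
    intro k
    simp only [Set.mem_preimage, mem_closedBall_zero_iff]
    change ‖InnerProductSpace.toDual ℝ H (x k)‖ ≤ M
    simpa using hM k
  obtain ⟨L, -, hL⟩ := hc.ultrafilter_le_nhds (U.map T) (by
    rw [le_principal_iff]
    exact Filter.mem_map.2 (Filter.univ_mem' hT))
  refine ⟨(InnerProductSpace.toDual ℝ H).symm (WeakDual.toStrongDual L), fun y => ?_⟩
  rw [InnerProductSpace.toDual_symm_apply]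
  have h3 : Tendsto T U (𝓝 L) := hL
  exact ((WeakDual.eval_continuous y).tendsto L).comp h3

lemma aux_opial {H : Type*} [NormedAddCommGroup H] [InnerProductSpace ℝ H] [CompleteSpace H]
    (lam : ℝ) (hlam : 0 < lam) (F : H → H)
    (hF : ∀ x y : H, lam * ‖F x - F y‖ ^ 2 ≤ ⟪F x - F y, x - y⟫_ℝ)
    (x : ℕ → H) (M : ℝ) (hM : ∀ k, ‖x k‖ ≤ M)
    (hFx : Tendsto (fun k => F (x k)) atTop (𝓝 0))
    (hz : ∀ z, F z = 0 → ∃ l, Tendsto (fun k => ‖x k - z‖ ^ 2) atTop (𝓝 l)) :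
    ∃ xb : H, F xb = 0 ∧
      ∀ y : H, Tendsto (fun k => ⟪x k, y⟫_ℝ) atTop (𝓝 ⟪xb, y⟫_ℝ) := by
  have hzero : ∀ (U : Ultrafilter ℕ), (U : Filter ℕ) ≤ atTop → ∀ xb : H,
      (∀ y : H, Tendsto (fun k => ⟪x k, y⟫_ℝ) U (𝓝 ⟪xb, y⟫_ℝ)) → F xb = 0 := by
    intro U hU xb hxb
    have hFU := hFx.mono_left hU
    have hl : Tendsto (fun k => lam * ‖F xb - F (x k)‖^2) U (𝓝 (lam * ‖F xb - 0‖^2)) :=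
      ((hFU.const_sub (F xb)).norm.pow 2).const_mul lam
    have hn : Tendsto (fun k => ‖F (x k)‖ * (‖xb‖ + M)) U (𝓝 0) := by
      have := hFU.norm.mul_const (‖xb‖ + M)
      simpa using this
    have hr : Tendsto (fun k => (⟪xb, F xb⟫_ℝ - ⟪x k, F xb⟫_ℝ) + ‖F (x k)‖ * (‖xb‖ + M)) U
        (𝓝 ((⟪xb, F xb⟫_ℝ - ⟪xb, F xb⟫_ℝ) + 0)) := ((hxb (F xb)).const_sub _).add hn
    have hle := le_of_tendsto_of_tendsto' hl hr fun k => by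
      refine (hF xb (x k)).trans ?_
      have h1 := (abs_le.1 (abs_real_inner_le_norm (F (x k)) (xb - x k))).1
      have h2 : ‖xb - x k‖ ≤ ‖xb‖ + M := (norm_sub_le _ _).trans (by linarith [hM k])
      have h3 := mul_le_mul_of_nonneg_left h2 (norm_nonneg (F (x k)))
      have h4 : ⟪F xb, xb - x k⟫_ℝ = ⟪xb, F xb⟫_ℝ - ⟪x k, F xb⟫_ℝ := by
        rw [inner_sub_right, real_inner_comm, real_inner_comm (x k)]
      rw [inner_sub_left, h4]
      linarith
    simp only [sub_zero, sub_self, add_zero] at hle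
    have : ‖F xb‖ ^ 2 ≤ 0 := by
      by_contra hc
      push Not at hc
      have := mul_pos hlam hc
      linarith
    have : ‖F xb‖ = 0 := by nlinarith [sq_nonneg ‖F xb‖]
    exact norm_eq_zero.1 this
  obtain ⟨U0, hU0⟩ := Ultrafilter.exists_le (atTop : Filter ℕ)
  obtain ⟨xb, hxb⟩ := aux_compact x M hM U0
  have hb0 := hzero U0 hU0 xb hxb
  refine ⟨xb, hb0, fun y => ?_⟩
  rw [tendsto_iff_ultrafilter]
  intro U hU
  obtain ⟨xc, hxc⟩ := aux_compact x M hM U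
  have hc0 := hzero U hU xc hxc
  suffices hEq : xc = xb by
    rw [← hEq]; exact hxc y
  obtain ⟨l1, h1⟩ := hz xb hb0
  obtain ⟨l2, h2⟩ := hz xc hc0
  have h3 : Tendsto (fun k => ⟪x k, xc - xb⟫_ℝ) atTop
      (𝓝 ((l1 - l2 - ‖xb‖^2 + ‖xc‖^2) / 2)) := by
    refine ((((h1.sub h2).sub_const _).add_const _).div_const 2).congr fun k => ?_
    rw [norm_sub_sq_real, norm_sub_sq_real, inner_sub_right]; ring
  have h4 := tendsto_nhds_unique (h3.mono_left hU0) (hxb _)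
  have h5 := tendsto_nhds_unique (h3.mono_left hU) (hxc _)
  have h6 : ⟪xc - xb, xc - xb⟫_ℝ = 0 := by rw [inner_sub_left]; linarith
  exact sub_eq_zero.1 (inner_self_eq_zero.1 h6)

lemma aux_nonsum (a : ℝ) (ha : 0 < a) : ¬ Summable (fun k : ℕ => 1 / (a * (k:ℝ) + 1)) := by
  intro h
  apply Real.not_summable_natCast_inv
  rw [← summable_nat_add_iff 1]
  refine Summable.of_nonneg_of_le (fun k => by positivity) (fun k => ?_) (h.mul_left (a + 1))
  have hk : (0:ℝ) ≤ k := Nat.cast_nonneg k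
  have h1 : 0 < a * (k:ℝ) + 1 := by positivity
  push_cast
  rw [mul_one_div, ← one_div, div_le_div_iff₀ (by positivity) h1]
  nlinarith

lemma aux_sq_diff {H : Type*} [NormedAddCommGroup H] (b c : H) (B : ℝ)
    (hb : ‖b‖ ≤ B) (hc : ‖c‖ ≤ B) : |‖b‖^2 - ‖c‖^2| ≤ 2 * B * ‖b - c‖ := by
  have e : ‖b‖^2 - ‖c‖^2 = (‖b‖ + ‖c‖) * (‖b‖ - ‖c‖) := by ring
  rw [e, abs_mul, abs_of_nonneg (by positivity)]
  exact mul_le_mul (by linarith) (abs_norm_sub_norm_le b c) (abs_nonneg _)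
    (by linarith [norm_nonneg b])

lemma aux_z {H : Type*} [NormedAddCommGroup H] [InnerProductSpace ℝ H]
    (F : H → H) (hmon : ∀ x y : H, 0 ≤ ⟪F x - F y, x - y⟫_ℝ)
    (μ β : ℝ) (hμ0 : 0 < μ) (hβ : 0 < β) (t P Q : ℕ → ℝ)
    (ht : ∀ k, 1 ≤ t k) (htm : ∀ k, t k ≤ t (k+1)) (hts : ¬ Summable (fun k => 1 / t k))
    (hPQ : ∀ k, P k = t k * Q k) (hQ1 : ∀ k, 1 ≤ Q k) (hQm : ∀ k, Q k ≤ Q (k+1))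
    (hP : ∀ k, P (k+1) - Q (k+1) + μ * Q (k+1) ≤ P k)
    (x v g : ℕ → H) (hv : ∀ k, v (k + 1) = t k • x (k + 1) - (t k - 1) • x k)
    (δ : ℕ → ℝ) (hδ0 : ∀ k, 0 ≤ δ k) (hδ : Summable δ) (hg : ∀ k, ‖g k‖ ≤ δ k)
    (hx : ∀ k, (0 : H) = P k • F (x (k + 1)) -
      (P k - Q k) • F (x k) + (v (k + 1) - v k) + β • (x (k + 1) - x k) + g k)
    (z : H) (hz : F z = 0) :
    (∃ B, ∀ k, ‖x (k+1) - z‖ ≤ B) ∧ Summable (fun k => ⟪F (x (k+1)), x (k+1) - z⟫_ℝ) ∧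
    ∃ l, Tendsto (fun k => ‖x (k+1) - z‖^2) atTop (𝓝 l) := by
  set φ : ℕ → ℝ := fun k => ⟪F (x (k+1)), x (k+1) - z⟫_ℝ with hφ
  have hφ0 : ∀ k, 0 ≤ φ k := fun k => by simpa [hz] using hmon (x (k+1)) z
  have hP0 : ∀ k, 0 ≤ P k := fun k => by
    rw [hPQ]; exact mul_nonneg (by linarith [ht k]) (by linarith [hQ1 k])
  set E : ℕ → ℝ := fun k => P k * φ k + 1/2 * ‖v (k+1) - z‖^2 + β/2 * ‖x (k+1) - z‖^2 with hE
  set A : ℕ → ℝ := fun k => μ * Q (k+1) * φ k + β/2 * (t (k+1) * ‖x (k+2) - x (k+1)‖^2) with hA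
  have hA1 : ∀ k, 0 ≤ μ * Q (k+1) * φ k := fun k =>
    mul_nonneg (mul_nonneg hμ0.le (by linarith [hQ1 (k+1)])) (hφ0 k)
  have hA2 : ∀ k, 0 ≤ t (k+1) * ‖x (k+2) - x (k+1)‖^2 := fun k =>
    mul_nonneg (by linarith [ht (k+1)]) (sq_nonneg _)
  have hA0 : ∀ k, 0 ≤ A k := fun k => add_nonneg (hA1 k) (mul_nonneg (by linarith) (hA2 k))
  have hEq : ∀ k, 0 ≤ P k * φ k := fun k => mul_nonneg (hP0 k) (hφ0 k)
  have hEv : ∀ k, 0 ≤ 1/2 * ‖v (k+1) - z‖^2 := fun k => by positivity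
  have hEx : ∀ k, 0 ≤ β/2 * ‖x (k+1) - z‖^2 := fun k => by positivity
  have hE0 : ∀ k, 0 ≤ E k := fun k => add_nonneg (add_nonneg (hEq k) (hEv k)) (hEx k)
  have hstep : ∀ k, E (k+1) + A k ≤ E k + δ (k+1) * Real.sqrt (2 * E (k+1)) := by
    intro k
    have h1 := aux_step_s14 (x (k+1)) (x (k+2)) (v (k+1)) (v (k+2)) (F (x (k+1))) (F (x (k+2)))
      (g (k+1)) z (t (k+1)) (P (k+1)) (Q (k+1)) (P k) μ β (δ (k+1)) (ht _)
      (by linarith [hQ1 (k+1)]) (hPQ _) (hP k) hβ (hv (k+1)) (hx (k+1)) (hg _) (hφ0 k)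
      (hmon _ _)
    have h2 : ‖v (k+2) - z‖ ≤ Real.sqrt (2 * E (k+1)) := by
      apply Real.le_sqrt_of_sq_le
      have := hEq (k+1)
      have := hEx (k+1)
      have e : E (k+1) = P (k+1) * φ (k+1) + 1/2 * ‖v (k+2) - z‖^2
        + β/2 * ‖x (k+1+1) - z‖^2 := rfl
      rw [e]
      linarith
    have h3 := mul_le_mul_of_nonneg_left h2 (hδ0 (k+1))
    simp only [hE, hA, hφ] at *
    linarith
  obtain ⟨⟨M, hM⟩, hAs, hEs⟩ := aux_energy E A (fun k => δ (k+1)) hE0 hA0 (fun k => hδ0 _)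
    ((summable_nat_add_iff 1).2 hδ) hstep
  have hM0 : 0 ≤ M := (hE0 0).trans (hM 0)
  have hQs : Summable (fun k => Q (k+1) * φ k) := by
    refine Summable.of_nonneg_of_le
      (fun k => mul_nonneg (by linarith [hQ1 (k+1)]) (hφ0 k)) (fun k => ?_) (hAs.mul_left (1/μ))
    have : μ * Q (k+1) * φ k ≤ A k := by
      have := mul_nonneg (by linarith : 0 ≤ β/2) (hA2 k)
      simp only [hA]; linarith
    rw [one_div, ← div_eq_inv_mul, le_div_iff₀ hμ0]
    linarith
  have hDs : Summable (fun k => t (k+1) * ‖x (k+2) - x (k+1)‖^2) := by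
    refine Summable.of_nonneg_of_le hA2 (fun k => ?_) (hAs.mul_left (1/(β/2)))
    have : β/2 * (t (k+1) * ‖x (k+2) - x (k+1)‖^2) ≤ A k := by
      have := hA1 k
      simp only [hA]; linarith
    rw [one_div, ← div_eq_inv_mul, le_div_iff₀ (by linarith)]
    linarith
  have hDs' : Summable (fun k => t k * ‖x (k+1) - x k‖^2) :=
    (summable_nat_add_iff 1).1 hDs
  -- bounds
  obtain ⟨B, hBx, hBv⟩ : ∃ B, (∀ k, ‖x (k+1) - z‖ ≤ B) ∧ (∀ k, ‖v (k+1) - z‖ ≤ B) := by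
    refine ⟨Real.sqrt (2 * M) + Real.sqrt (2 / β * M), fun k => ?_, fun k => ?_⟩
    · have : ‖x (k+1) - z‖ ≤ Real.sqrt (2 / β * M) := by
        apply Real.le_sqrt_of_sq_le
        have h1 : β/2 * ‖x (k+1) - z‖^2 ≤ M := by
          have := hM k
          have := hEq k
          have := hEv k
          simp only [hE] at *
          linarith
        rw [div_mul_eq_mul_div, le_div_iff₀ hβ]
        linarith
      linarith [Real.sqrt_nonneg (2 * M)]
    · have : ‖v (k+1) - z‖ ≤ Real.sqrt (2 * M) := by
        apply Real.le_sqrt_of_sq_le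
        have := hM k
        have := hEq k
        have := hEx k
        simp only [hE] at *
        linarith
      linarith [Real.sqrt_nonneg (2 / β * M)]
  have hB0 : 0 ≤ B := (norm_nonneg _).trans (hBx 0)
  refine ⟨⟨B, hBx⟩, ?_, ?_⟩
  · refine Summable.of_nonneg_of_le hφ0 (fun k => ?_) hQs
    have := mul_le_mul_of_nonneg_right (hQ1 (k+1)) (hφ0 k)
    simpa using this
  have ht0 : ∀ k, 0 < t k := fun k => by linarith [ht k]
  set h : ℕ → ℝ := fun k => ‖x (k+1) - z‖^2 with hh
  set u : ℕ → ℝ := fun k => t k * ‖x (k+1) - x k‖ with hu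
  set w : ℕ → ℝ := fun k => E k - (1+β)/2 * h k with hw
  have hhB : ∀ k, h k ≤ B^2 := fun k => pow_le_pow_left₀ (norm_nonneg _) (hBx k) 2
  have hh0 : ∀ k, 0 ≤ h k := fun k => sq_nonneg _
  have hwq : ∀ k, |w k| ≤ P k * φ k + B * u k := by
    intro k
    have e : w k = P k * φ k + 1/2 * (‖v (k+1) - z‖^2 - ‖x (k+1) - z‖^2) := by
      simp only [hw, hE, hh]; ring
    have h1 := aux_sq_diff (v (k+1) - z) (x (k+1) - z) B (hBv k) (hBx k)
    have e2 : v (k+1) - z - (x (k+1) - z) = (t k - 1) • (x (k+1) - x k) := by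
      rw [hv]; module
    rw [e2, norm_smul, Real.norm_of_nonneg (by linarith [ht k])] at h1
    have h2 : (t k - 1) * ‖x (k+1) - x k‖ ≤ u k := by
      simp only [hu]; nlinarith [norm_nonneg (x (k+1) - x k)]
    have h3 := mul_le_mul_of_nonneg_left h2 hB0
    rw [e]
    refine (abs_add_le _ _).trans ?_
    rw [abs_of_nonneg (hEq k), abs_mul, abs_of_pos (by norm_num : (0:ℝ) < 1/2)]
    linarith
  have hsu : ∀ k, 1 / t k * u k ^ 2 = t k * ‖x (k+1) - x k‖^2 := by
    intro k
    have := (ht0 k).ne'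
    simp only [hu]; field_simp
  have hsu' : ∀ k, 1 / t k * u k = ‖x (k+1) - x k‖ := by
    intro k
    have := (ht0 k).ne'
    simp only [hu]; field_simp
  refine aux_slow E h w (fun k => 1 / t k) u ((1+β)/2) (2 * B) (M + (1+β)/2 * B^2)
    (by linarith) (by linarith) (fun k => rfl) ?_ hEs (fun k => (by have := ht0 k; positivity))
    (fun k => one_div_le_one_div_of_le (ht0 k) (htm k)) hts ?_ ?_ ?_
  · intro k
    have h1 := mul_le_mul_of_nonneg_left (hhB k) (by linarith : 0 ≤ (1+β)/2)
    have h2 := mul_nonneg (by linarith : 0 ≤ (1+β)/2) (hh0 k)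
    have := hM k
    have := hE0 k
    simp only [hw]
    rw [abs_le]; constructor <;> linarith
  · refine Summable.of_nonneg_of_le
      (fun k => mul_nonneg (by have := ht0 k; positivity) (sq_nonneg _)) (fun k => ?_)
      ((hQs.mul_left (2 * M)).add (hDs'.mul_left (2 * B^2)))
    have hqM : P k * φ k ≤ M := by
      have := hM k
      have := hEx k
      have := hEv k
      simp only [hE] at *
      linarith
    have h1 : w k ^ 2 ≤ 2 * M * (P k * φ k) + 2 * B^2 * u k ^ 2 := by
      have h2 : w k ^ 2 ≤ (P k * φ k + B * u k)^2 := by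
        rw [← sq_abs]; exact pow_le_pow_left₀ (abs_nonneg _) (hwq k) 2
      have h3 := mul_le_mul_of_nonneg_right hqM (hEq k)
      nlinarith [sq_nonneg (P k * φ k - B * u k)]
    have h4 : 1 / t k * w k ^ 2 ≤ 1 / t k * (2 * M * (P k * φ k) + 2 * B^2 * u k ^ 2) :=
      mul_le_mul_of_nonneg_left h1 (by have := ht0 k; positivity)
    have h5 : 1 / t k * (2 * M * (P k * φ k) + 2 * B^2 * u k ^ 2) =
        2 * M * (Q k * φ k) + 2 * B^2 * (t k * ‖x (k+1) - x k‖^2) := by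
      rw [← hsu, hPQ]
      have := (ht0 k).ne'
      field_simp
    have h6 := mul_le_mul_of_nonneg_left (mul_le_mul_of_nonneg_right (hQm k) (hφ0 k))
      (by linarith : 0 ≤ 2 * M)
    linarith
  · simpa only [hsu] using hDs'
  · intro k
    rw [hsu']
    have h1 := aux_sq_diff (x (k+1+1) - z) (x (k+1) - z) B (hBx (k+1)) (hBx k)
    rwa [sub_sub_sub_cancel_right] at h1

/-- The inexact Sublinear Contracting PPA with `μ ∈ (0,1)` and `β > 0`,
applied to a λ-cocoercive operator `F` with `F x_* = 0`, converges weakly to a zero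
of `F`. -/
theorem sublinear_contracting_ppa_weak_convergence
    {H : Type*} [NormedAddCommGroup H] [InnerProductSpace ℝ H] [CompleteSpace H]
    (lam : ℝ) (hlam : 0 < lam) (F : H → H)
    (hF : ∀ x y : H, lam * ‖F x - F y‖ ^ 2 ≤ ⟪F x - F y, x - y⟫_ℝ)
    (μ p a : ℝ) (hμ0 : 0 < μ) (hμ1 : μ < 1) (hp : 1 ≤ p)
    (ha0 : 0 < a) (ha : a ≤ (1 - μ) / p)
    (τ : ℕ → ℝ) (hτ : ∀ k : ℕ, τ k = 1 / (a * (k : ℝ) + 1))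
    (τneg : ℝ) (hτneg0 : 0 < τneg) (hτneg1 : τneg ≤ 1)
    (x : ℕ → H)
    (v : ℕ → H)
    (hv0 : v 0 = (1 / τneg) • x 0 - ((1 - τneg) / τneg) • x 0)
    (hv : ∀ k, v (k + 1) = (1 / τ k) • x (k + 1) - ((1 - τ k) / τ k) • x k)
    (β : ℝ) (hβ : 0 < β)
    (δ : ℕ → ℝ) (hδ0 : ∀ k, 0 ≤ δ k) (hδ : Summable δ)
    (g : ℕ → H) (hg : ∀ k, ‖g k‖ ≤ δ k)
    (hx : ∀ k, (0 : H) = (1 / τ k ^ p) • F (x (k + 1)) -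
      ((1 - τ k) / τ k ^ p) • F (x k) + (v (k + 1) - v k) +
      β • (x (k + 1) - x k) + g k)
    (xs : H) (hxs : F xs = 0) :
    ∃ xb : H, F xb = 0 ∧
      ∀ y : H, Tendsto (fun k => ⟪x k, y⟫_ℝ) atTop (𝓝 ⟪xb, y⟫_ℝ) := by
  have ht1 : ∀ k : ℕ, 1 ≤ a * (k:ℝ) + 1 := fun k => by
    have : 0 ≤ a * (k:ℝ) := by positivity
    linarith
  have ht0 : ∀ k : ℕ, 0 < a * (k:ℝ) + 1 := fun k => by linarith [ht1 k]
  have hPQ : ∀ k : ℕ, (a * (k:ℝ) + 1) ^ p = (a * (k:ℝ) + 1) * (a * (k:ℝ) + 1) ^ (p - 1) := by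
    intro k
    rw [Real.rpow_sub_one (ht0 k).ne']
    have := (ht0 k).ne'
    field_simp
  have htm : ∀ k : ℕ, a * (k:ℝ) + 1 ≤ a * ((k+1 : ℕ):ℝ) + 1 := fun k => by
    push_cast; linarith
  have hτp : ∀ k, 1 / τ k ^ p = (a * (k:ℝ) + 1) ^ p := by
    intro k
    rw [hτ, Real.div_rpow zero_le_one (ht0 k).le, Real.one_rpow, one_div_one_div]
  have hmon : ∀ x y : H, 0 ≤ ⟪F x - F y, x - y⟫_ℝ := fun x y =>
    le_trans (by positivity) (hF x y)
  have hP : ∀ k : ℕ, (a * ((k+1 : ℕ):ℝ) + 1) ^ p - (a * ((k+1 : ℕ):ℝ) + 1) ^ (p-1)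
      + μ * (a * ((k+1 : ℕ):ℝ) + 1) ^ (p-1) ≤ (a * (k:ℝ) + 1) ^ p := by
    intro k
    set T := a * ((k+1 : ℕ):ℝ) + 1 with hT
    have hT0 : 0 < T := ht0 (k+1)
    have e : a * (k:ℝ) + 1 = T * (1 + (-(a / T))) := by
      have : T ≠ 0 := hT0.ne'
      field_simp
      rw [hT]; push_cast; ring
    have haT : a / T ≤ 1 := by
      rw [div_le_one hT0, hT]; push_cast
      have : 0 ≤ a * (k:ℝ) := by positivity
      linarith
    have hb := one_add_mul_self_le_rpow_one_add (s := -(a/T)) (by linarith) hp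
    rw [e, Real.mul_rpow hT0.le (by linarith)]
    have hTp : T ^ p = T * T ^ (p-1) := hPQ (k+1)
    have hq : 0 < T ^ (p-1) := Real.rpow_pos_of_pos hT0 _
    have h1 := mul_le_mul_of_nonneg_left hb (Real.rpow_pos_of_pos hT0 p).le
    have h2 : T ^ p * (1 + p * -(a/T)) = T ^ p - p * a * T ^ (p-1) := by
      rw [hTp]; field_simp; ring
    have h3 : p * a ≤ 1 - μ := by
      rw [le_div_iff₀ (by linarith)] at ha; linarith
    have h4 := mul_le_mul_of_nonneg_right h3 hq.le
    linarith
  have key := fun z hz => aux_z F hmon μ β hμ0 hβ (fun k : ℕ => a * (k:ℝ) + 1)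
    (fun k : ℕ => (a * (k:ℝ) + 1) ^ p) (fun k : ℕ => (a * (k:ℝ) + 1) ^ (p-1))
    ht1 htm (aux_nonsum a ha0) hPQ
    (fun k => Real.one_le_rpow (ht1 k) (by linarith))
    (fun k => Real.rpow_le_rpow (ht0 k).le (htm k) (by linarith)) hP x v g
    (fun k => by
      rw [hv k, hτ k]
      have := (ht0 k).ne'
      congr 2
      · rw [one_div_one_div]
      · field_simp)
    δ hδ0 hδ hg
    (fun k => by
      have e := hx k
      have e2 : (1 - τ k) / τ k ^ p = (a * (k:ℝ) + 1) ^ p - (a * (k:ℝ) + 1) ^ (p-1) := by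
        have := (ht0 k).ne'
        rw [div_eq_mul_one_div, hτp, hPQ k, hτ k]
        field_simp
      rw [e2, hτp] at e
      exact e) z hz
  obtain ⟨⟨B, hB⟩, hs, -⟩ := key xs hxs
  have hFx : Tendsto (fun k => F (x (k+1))) atTop (𝓝 0) := by
    rw [tendsto_zero_iff_norm_tendsto_zero]
    have h1 : Tendsto (fun k => ‖F (x (k+1))‖^2) atTop (𝓝 0) := by
      have h2 := hs.tendsto_atTop_zero.div_const lam
      rw [zero_div] at h2
      refine squeeze_zero (fun k => sq_nonneg _) (fun k => ?_) h2
      rw [le_div_iff₀ hlam]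
      have := hF (x (k+1)) xs
      rw [hxs, sub_zero] at this
      linarith
    have := h1.sqrt
    simpa using this
  obtain ⟨xb, hxb, hw⟩ := aux_opial lam hlam F hF (fun k => x (k+1)) (B + ‖xs‖)
    (fun k => by
      have := norm_add_le (x (k+1) - xs) xs
      rw [sub_add_cancel] at this
      linarith [hB k]) hFx (fun z hz => (key z hz).2.2)
  exact ⟨xb, hxb, fun y => (tendsto_add_atTop_iff_nat 1).1 (hw y)⟩
end
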